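/- Let q ≥ 2 be an integer, and let R be the set of distinct complex roots of Qq that are different from -1. Then for every a ∈ R one has a ≠ 0 and Qq'(a) ≠ 0, and ∑_{a ∈ R} 2(a^(4q) - 1)³ · (a^(4q) - (a² + a + 1)a^(2q-1) + 1) / (a^(4q+1) · Qq'(a)) = 0. -/

import Mathlib

open Polynomial

/-- The polynomial `Qq(X) = 1 - X^(2q) - X^(4q-1) - 2X^(4q) - X^(4q+1) - X^(6q) + X^(8q)`
in `ℤ[X]` (for `q ≥ 1`). -/
noncomputable def Qq (q : ℕ) : Polynomial ℤ :=
  1 - X ^ (2 * q) - X ^ (4 * q - 1) - 2 * X ^ (4 * q) - X ^ (4 * q + 1) - X ^ (6 * q) +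
    X ^ (8 * q)

/-- The set of distinct complex roots of `Qq`. -/
noncomputable def QqRoots (q : ℕ) : Finset ℂ :=
  ((Qq q).map (Int.castRingHom ℂ)).roots.toFinset

/-- Euler's identity: the residues of `P / ∏ (X - a)` sum to zero when the degree of `P` is at
least two less than the number of poles. -/
theorem sum_eval_div_derivative_nodal_eq_zero {F : Type*} [Field F] (s : Finset F) (P : F[X])
    (hP : P.natDegree + 1 < s.card) :
    ∑ a ∈ s, P.eval a / (derivative (Lagrange.nodal s id)).eval a = 0 := by
  classical
  have hd : P.degree < s.card :=
    lt_of_le_of_lt degree_le_natDegree (by exact_mod_cast (by omega : P.natDegree < s.card))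
  have h := Lagrange.coeff_eq_sum (s := s) (v := id) (Set.injOn_id _) hd
  rw [coeff_eq_zero_of_natDegree_lt (by omega)] at h
  rw [h]
  refine Finset.sum_congr rfl fun a ha => ?_
  have h' := Lagrange.eval_nodal_derivative_eval_node_eq (v := id) ha
  simp only [id] at h' ⊢
  rw [h', Lagrange.eval_nodal]
  rfl

theorem exists_int_of_isIntegral_ratCast {r : ℚ} (h : IsIntegral ℤ (r : ℂ)) :
    ∃ k : ℤ, (k : ℚ) = r := by
  have h' : IsIntegral ℤ (algebraMap ℚ ℂ r) := by simpa using h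
  rw [isIntegral_algebraMap_iff (algebraMap ℚ ℂ).injective] at h'
  exact IsIntegrallyClosed.isIntegral_iff.mp h'

/-- A quadratic with non-real roots whose sum `(N - 1) / N` is not an integer has no integral
root. -/
theorem not_isIntegral_of_quadratic {N c : ℤ} (hN : 1 < N) (hc : (N - 1) ^ 2 < 4 * N * c) {z : ℂ}
    (hz : (N : ℂ) * z ^ 2 - (N - 1) * z + c = 0) : ¬ IsIntegral ℤ z := by
  intro hint
  have hre := congrArg Complex.re hz
  have him := congrArg Complex.im hz
  simp [pow_two] at hre him
  have hc' : ((N : ℝ) - 1) ^ 2 < 4 * N * c := by exact_mod_cast hc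
  have hN' : (1 : ℝ) < N := by exact_mod_cast hN
  have hy : z.im ≠ 0 := by
    intro hy
    simp only [hy] at hre
    nlinarith [sq_nonneg (2 * (N : ℝ) * z.re - (N - 1))]
  have hx : 2 * (N : ℝ) * z.re = N - 1 := by
    apply mul_left_cancel₀ hy
    linarith
  have hconj : IsIntegral ℤ ((starRingEnd ℂ) z) :=
    hint.map (Complex.conjAe.toAlgHom.restrictScalars ℤ)
  have hsum : z + (starRingEnd ℂ) z = (((N - 1) / N : ℚ) : ℂ) := by
    rw [Complex.add_conj]
    have h2 : (2 * z.re : ℝ) = ((N : ℝ) - 1) / N := by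
      field_simp
      linarith
    rw [h2]
    push_cast
    rfl
  obtain ⟨k, hk⟩ := exists_int_of_isIntegral_ratCast (hsum ▸ hint.add hconj)
  have hNQ : (N : ℚ) ≠ 0 := by exact_mod_cast (by omega : N ≠ 0)
  rw [eq_div_iff hNQ] at hk
  have hk' : k * N = N - 1 := by exact_mod_cast hk
  have hdvd : N ∣ 1 := ⟨1 - k, by linarith⟩
  have := Int.le_of_dvd one_pos hdvd
  omega

section Roots

variable {n : ℕ} {a : ℂ}

theorem mem_QqRoots_iff : a ∈ QqRoots (n + 2) ↔ aeval a (Qq (n + 2)) = 0 := by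
  have hne : (Qq (n + 2)).map (Int.castRingHom ℂ) ≠ 0 := by
    intro h
    have := congrArg (eval 0) h
    have h0 : 4 * (n + 2) - 1 ≠ 0 := by omega
    simp [Qq, h0] at this
  rw [QqRoots, Multiset.mem_toFinset, mem_roots hne, IsRoot.def, eval_map, aeval_def]
  rfl

theorem aeval_Qq_mul (a : ℂ) (n : ℕ) : a * aeval a (Qq (n + 2)) =
    a * (1 - a ^ (2 * (n + 2)) - 2 * (a ^ (2 * (n + 2))) ^ 2 - (a ^ (2 * (n + 2))) ^ 3
      + (a ^ (2 * (n + 2))) ^ 4) - (a ^ (2 * (n + 2))) ^ 2 * (1 + a ^ 2) := by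
  have h1 : 4 * (n + 2) - 1 = 4 * n + 7 := by omega
  simp only [Qq, h1, map_add, map_sub, map_mul, map_pow, aeval_X, map_one, map_ofNat]
  ring

theorem aeval_derivative_Qq (a : ℂ) (n : ℕ) : aeval a (derivative (Qq (n + 2))) =
    -(2 * n + 4) * a ^ (2 * n + 3) - (4 * n + 7) * a ^ (4 * n + 6)
      - 2 * (4 * n + 8) * a ^ (4 * n + 7) - (4 * n + 9) * a ^ (4 * n + 8)
      - (6 * n + 12) * a ^ (6 * n + 11) + (8 * n + 16) * a ^ (8 * n + 15) := by
  have h1 : 4 * (n + 2) - 1 = 4 * n + 7 := by omega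
  have h2 : 2 * (n + 2) - 1 = 2 * n + 3 := by omega
  have h3 : 6 * (n + 2) - 1 = 6 * n + 11 := by omega
  have h4 : 8 * (n + 2) - 1 = 8 * n + 15 := by omega
  have h5 : 4 * n + 7 - 1 = 4 * n + 6 := by omega
  have h6 : 4 * (n + 2) + 1 - 1 = 4 * n + 8 := by omega
  have e : derivative (2 * X ^ (4 * (n + 2)) : ℤ[X]) = 2 * derivative (X ^ (4 * (n + 2))) := by
    rw [show (2 : ℤ[X]) = C 2 from rfl, derivative_C_mul]
  simp only [Qq, map_add, map_sub, derivative_one, derivative_X_pow, e, h1, h2, h3,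
    h4, h5, h6, map_mul, map_pow, aeval_X, map_zero, map_ofNat, map_natCast]
  push_cast
  ring

theorem aeval_derivative_Qq_mul (a : ℂ) (n : ℕ) : a ^ 2 * aeval a (derivative (Qq (n + 2))) =
    a * (n + 2) * (4 * (a ^ (2 * (n + 2))) ^ 4 - 2 * (a ^ (2 * (n + 2))) ^ 3
      + 2 * a ^ (2 * (n + 2)) - 4) + (a ^ (2 * (n + 2))) ^ 2 * (1 - a ^ 2)
      + 4 * (n + 2) * (a * aeval a (Qq (n + 2))) := by
  rw [aeval_Qq_mul, aeval_derivative_Qq]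
  ring

theorem ne_zero_of_aeval_Qq (h : aeval a (Qq (n + 2)) = 0) : a ≠ 0 := by
  rintro rfl
  have h0 : 4 * (n + 2) - 1 ≠ 0 := by omega
  simp [Qq, h0] at h

theorem natDegree_Qq (n : ℕ) : (Qq (n + 2)).natDegree = 8 * (n + 2) := by
  rw [Qq]
  compute_degree!
  · repeat rw [if_neg (by omega)]
    simp
  all_goals omega

theorem monic_Qq (n : ℕ) : (Qq (n + 2)).Monic := by
  rw [Monic, leadingCoeff, natDegree_Qq, Qq]
  have h2 : (2 : ℤ[X]) = C 2 := rfl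
  simp only [h2, coeff_add, coeff_sub, coeff_X_pow, coeff_one, coeff_C_mul]
  repeat rw [if_neg (by omega)]
  simp

theorem isIntegral_of_aeval_Qq (h : aeval a (Qq (n + 2)) = 0) : IsIntegral ℤ a :=
  ⟨Qq (n + 2), monic_Qq n, by simpa [aeval_def] using h⟩

theorem isIntegral_inv_of_aeval_Qq (h : aeval a (Qq (n + 2)) = 0) : IsIntegral ℤ a⁻¹ := by
  have ha := ne_zero_of_aeval_Qq h
  have hi := isIntegral_of_aeval_Qq h
  have e : a⁻¹ = a ^ (2 * n + 3) + a ^ (4 * n + 6) + 2 * a ^ (4 * n + 7) + a ^ (4 * n + 8)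
      + a ^ (6 * n + 11) - a ^ (8 * n + 15) := by
    have h' := aeval_Qq_mul a n
    rw [h, mul_zero] at h'
    apply mul_left_cancel₀ (pow_ne_zero 2 ha)
    rw [pow_two, mul_assoc, mul_inv_cancel₀ ha]
    linear_combination -h'
  rw [e]
  have h2 : IsIntegral ℤ (2 : ℂ) := by simpa using isIntegral_natCast (R := ℤ) (B := ℂ) 2
  exact (((((hi.pow _).add (hi.pow _)).add (h2.mul (hi.pow _))).add (hi.pow _)).add
    (hi.pow _)).sub (hi.pow _)

theorem sq_sub_one_sq_mul_of_aeval_Qq (h : aeval a (Qq (n + 2)) = 0) :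
    (a ^ 2 - 1) ^ 2 * (a ^ (2 * (n + 2))) ^ 4 = a ^ 2 * ((a ^ (2 * (n + 2))) ^ 2 - 1) ^ 2 *
      (((a ^ (2 * (n + 2))) ^ 2 - 3 * a ^ (2 * (n + 2)) + 1) *
        ((a ^ (2 * (n + 2))) ^ 2 + a ^ (2 * (n + 2)) + 1)) := by
  have h' := aeval_Qq_mul a n
  rw [h, mul_zero] at h'
  generalize a ^ (2 * (n + 2)) = u at *
  linear_combination (u ^ 2 * (1 + a ^ 2) + a * (1 - u - 2 * u ^ 2 - u ^ 3 + u ^ 4)) * h'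

theorem aeval_derivative_Qq_ne_zero (h : aeval a (Qq (n + 2)) = 0) (h1 : a ≠ -1) :
    aeval a (derivative (Qq (n + 2))) ≠ 0 := by
  intro hd
  have ha := ne_zero_of_aeval_Qq h
  have hi := isIntegral_of_aeval_Qq h
  have hii := isIntegral_inv_of_aeval_Qq h
  have hsq := sq_sub_one_sq_mul_of_aeval_Qq h
  have h0 := aeval_Qq_mul a n
  have hd0 := aeval_derivative_Qq_mul a n
  rw [h, hd] at hd0
  rw [h] at h0
  have hint : IsIntegral ℤ (a ^ (2 * (n + 2)) + (a ^ (2 * (n + 2)))⁻¹) := by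
    rw [← inv_pow]
    exact (hi.pow _).add (hii.pow _)
  have hu : a ^ (2 * (n + 2)) ≠ 0 := pow_ne_zero _ ha
  have hu1 : a = 1 → a ^ (2 * (n + 2)) = 1 := by rintro rfl; simp
  generalize a ^ (2 * (n + 2)) = u at *
  have hfac : a ^ 2 * (u ^ 2 - 1) ^ 2 * ((u ^ 2 - 3 * u + 1) * (u ^ 2 + u + 1) -
      (n + 2) ^ 2 * (4 * u ^ 2 - 2 * u + 4) ^ 2) = 0 := by
    linear_combination (-1 : ℂ) * hsq - (u ^ 2 * (1 - a ^ 2) -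
      a * (n + 2) * (4 * u ^ 4 - 2 * u ^ 3 + 2 * u - 4)) * hd0
  have hu2 : u ^ 2 - 1 ≠ 0 := by
    intro hu2
    have : (u - 1) * (u + 1) = 0 := by linear_combination hu2
    rcases mul_eq_zero.mp this with hu' | hu'
    · obtain rfl : u = 1 := by linear_combination hu'
      have : (a + 1) ^ 2 = 0 := by linear_combination h0
      exact h1 (by linear_combination pow_eq_zero_iff two_ne_zero |>.mp this)
    · obtain rfl : u = -1 := by linear_combination hu'
      have : (a - 1) ^ 2 = 0 := by linear_combination h0
      have := hu1 (by linear_combination pow_eq_zero_iff two_ne_zero |>.mp this)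
      norm_num at this
  have hq := (mul_eq_zero.mp hfac).resolve_left
    (mul_ne_zero (pow_ne_zero 2 ha) (pow_ne_zero 2 hu2))
  refine not_isIntegral_of_quadratic (N := 16 * (n + 2) ^ 2 - 1) (c := 4 * (n + 2) ^ 2 + 3)
    (by nlinarith [n.cast_nonneg (α := ℤ)]) ?_ ?_ hint
  · nlinarith [n.cast_nonneg (α := ℤ), sq_nonneg (n : ℤ)]
  push_cast
  field_simp
  linear_combination (-1 : ℂ) * hq

theorem summand_eq (h : aeval a (Qq (n + 2)) = 0) :
    2 * (a ^ (4 * (n + 2)) - 1) ^ 3 *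
        (a ^ (4 * (n + 2)) - (a ^ 2 + a + 1) * a ^ (2 * (n + 2) - 1) + 1) / a ^ (4 * (n + 2) + 1) =
      -2 * ((a + 1) ^ 2 * ((a ^ (4 * n + 8) - 1) * (a - 1) ^ 2 * a ^ (2 * n + 1))) := by
  have ha := ne_zero_of_aeval_Qq h
  have hsq := sq_sub_one_sq_mul_of_aeval_Qq h
  have h0 := aeval_Qq_mul a n
  rw [h, mul_zero] at h0
  rw [div_eq_iff (pow_ne_zero _ ha)]
  have e1 : 2 * (n + 2) - 1 = 2 * n + 3 := by omega
  have e2 : a ^ (2 * n + 3) = a ^ (2 * n + 1) * a ^ 2 := by ring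
  have e3 : a ^ (4 * (n + 2)) = (a ^ (2 * (n + 2))) ^ 2 := by ring
  have e4 : a ^ (4 * n + 8) = (a ^ (2 * (n + 2))) ^ 2 := by ring
  have e5 : a ^ (4 * (n + 2) + 1) = (a ^ (2 * (n + 2))) ^ 2 * a := by ring
  have e6 : a ^ (2 * (n + 2)) = a ^ (2 * n + 1) * a ^ 3 := by ring
  rw [e1, e2, e3, e4, e5]
  have hu : a ^ (2 * (n + 2)) ≠ 0 := pow_ne_zero _ ha
  generalize a ^ (2 * (n + 2)) = u at *
  generalize a ^ (2 * n + 1) = b at *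
  apply mul_left_cancel₀ (mul_ne_zero (pow_ne_zero 2 ha) hu)
  linear_combination (2 * (u ^ 2 - 1) ^ 3 * u * (a ^ 2 + a + 1) * a -
    2 * (u ^ 2 - 1) * (a ^ 2 - 1) ^ 2 * u ^ 3) * e6 + 2 * (u ^ 2 - 1) * hsq -
    2 * (u ^ 2 - 1) ^ 3 * a * h0

theorem aeval_neg_one_derivative_derivative_Qq (n : ℕ) :
    aeval (-1 : ℂ) (derivative (derivative (Qq (n + 2)))) = 2 * (12 * (n + 2) ^ 2 + 1) := by
  have h1 : 4 * (n + 2) - 1 = 4 * n + 7 := by omega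
  have e : derivative (derivative (2 * X ^ (4 * (n + 2)) : ℤ[X])) =
      2 * derivative (derivative (X ^ (4 * (n + 2)))) := by
    rw [show (2 : ℤ[X]) = C 2 from rfl, derivative_C_mul, derivative_C_mul]
  have e' : ∀ k : ℕ, aeval (-1 : ℂ) (derivative (derivative (X ^ (k + 2) : ℤ[X]))) =
      (k + 2) * (k + 1) * (-1) ^ k := fun k => by
    simp [derivative_mul]
    ring
  simp only [Qq, h1, map_add, map_sub, e, map_mul, derivative_one, map_zero, map_ofNat]
  rw [show 2 * (n + 2) = 2 * (n + 1) + 2 by ring, show 4 * n + 7 = 4 * n + 5 + 2 by ring,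
    show 4 * (n + 2) + 1 = 4 * n + 7 + 2 by ring, show 4 * (n + 2) = 4 * n + 6 + 2 by ring,
    show 6 * (n + 2) = 6 * n + 10 + 2 by ring, show 8 * (n + 2) = 8 * n + 14 + 2 by ring]
  simp only [e']
  simp only [pow_add, pow_mul]
  norm_num
  ring

theorem exists_Qq_map_eq_sq_mul (n : ℕ) : ∃ T : ℂ[X],
    (Qq (n + 2)).map (Int.castRingHom ℂ) = (X + 1) ^ 2 * T ∧ T.eval (-1) ≠ 0 := by
  have hX : (X + 1 : ℂ[X]) = X - C (-1) := by simp
  have he : ∀ p : ℤ[X], (p.map (Int.castRingHom ℂ)).eval (-1) = aeval (-1 : ℂ) p := fun p => by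
    rw [eval_map, aeval_def]; rfl
  have h0 : aeval (-1 : ℂ) (Qq (n + 2)) = 0 := by
    have := aeval_Qq_mul (-1) n
    simp only [pow_mul, neg_one_sq, one_pow] at this
    linear_combination -this
  have h1 : aeval (-1 : ℂ) (derivative (Qq (n + 2))) = 0 := by
    have := aeval_derivative_Qq_mul (-1) n
    rw [h0] at this
    simp only [pow_mul, neg_one_sq, one_pow] at this
    linear_combination this
  have h2 := aeval_neg_one_derivative_derivative_Qq n
  rw [← he] at h0 h1 h2
  obtain ⟨S, hS⟩ := dvd_iff_isRoot.mpr h0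
  rw [← hX] at hS
  rw [← derivative_map, hS] at h1
  obtain ⟨T, rfl⟩ := dvd_iff_isRoot.mpr (show S.IsRoot (-1) by simpa using h1)
  rw [← hX] at hS
  refine ⟨T, by rw [hS]; ring, fun hT => ?_⟩
  rw [← derivative_map, ← derivative_map, hS] at h2
  simp [hT] at h2
  have h3 : 12 * (n + 2) ^ 2 + 1 = 0 := by exact_mod_cast h2
  omega

end Roots

/-- for `q ≥ 2`, with `R` the set of distinct complex roots of `Qq` different
from `-1`: every `a ∈ R` satisfies `a ≠ 0` and `Qq'(a) ≠ 0`, and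
`∑_{a ∈ R} 2(a^{4q}-1)³(a^{4q} - (a²+a+1)a^{2q-1} + 1) / (a^{4q+1} Qq'(a)) = 0`. -/
theorem stmt14 (q : ℕ) (hq : 2 ≤ q) :
    (∀ a ∈ QqRoots q \ {-1},
        a ≠ 0 ∧ Polynomial.aeval a (derivative (Qq q)) ≠ 0) ∧
    ∑ a ∈ QqRoots q \ {-1},
        2 * (a ^ (4 * q) - 1) ^ 3 * (a ^ (4 * q) - (a ^ 2 + a + 1) * a ^ (2 * q - 1) + 1) /
          (a ^ (4 * q + 1) * Polynomial.aeval a (derivative (Qq q))) = 0 := by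
  obtain ⟨n, rfl⟩ : ∃ n, q = n + 2 := ⟨q - 2, by omega⟩
  have hroot : ∀ a ∈ QqRoots (n + 2) \ {-1}, aeval a (Qq (n + 2)) = 0 ∧ a ≠ -1 := fun a ha => by
    simpa [mem_QqRoots_iff] using ha
  refine ⟨fun a ha => ⟨ne_zero_of_aeval_Qq (hroot a ha).1,
    aeval_derivative_Qq_ne_zero (hroot a ha).1 (hroot a ha).2⟩, ?_⟩
  obtain ⟨T, hT, hT1⟩ := exists_Qq_map_eq_sq_mul n
  have hX : (X + 1 : ℂ[X]) = X + C 1 := by simp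
  have hmon : T.Monic := by
    refine Monic.of_mul_monic_left (p := (X + 1) ^ 2) ?_ ?_
    · rw [hX]
      exact (monic_X_add_C 1).pow 2
    · rw [← hT]
      exact (monic_Qq n).map _
  have hdeg : T.natDegree = 8 * n + 14 := by
    have := congrArg natDegree hT
    rw [(monic_Qq n).natDegree_map, natDegree_Qq, hX,
      ((monic_X_add_C 1).pow 2).natDegree_mul hmon, (monic_X_add_C (1 : ℂ)).natDegree_pow,
      natDegree_X_add_C] at this
    omega
  have heval : ∀ a : ℂ, aeval a (Qq (n + 2)) = (a + 1) ^ 2 * T.eval a := fun a => by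
    simpa [eval_map, aeval_def] using congrArg (eval a) hT
  have hderiv : ∀ a : ℂ, T.eval a = 0 →
      aeval a (derivative (Qq (n + 2))) = (a + 1) ^ 2 * (derivative T).eval a := fun a ha => by
    have := congrArg (fun p => eval a (derivative p)) hT
    simpa [eval_map, aeval_def, derivative_map, derivative_mul, ha] using this
  have hmem : ∀ a : ℂ, T.eval a = 0 ↔ a ∈ QqRoots (n + 2) \ {-1} := fun a => by
    rw [Finset.mem_sdiff, mem_QqRoots_iff, heval, Finset.mem_singleton]
    constructor
    · intro h
      exact ⟨by simp [h], fun h' => hT1 (h' ▸ h)⟩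
    · rintro ⟨h, h'⟩
      refine (mul_eq_zero.mp h).resolve_left (pow_ne_zero 2 fun h'' => h' ?_)
      linear_combination h''
  have hnodup : T.roots.Nodup := by
    rw [Multiset.nodup_iff_count_le_one]
    intro a
    rw [count_roots]
    by_contra! hlt
    obtain ⟨h0, h1⟩ := (one_lt_rootMultiplicity_iff_isRoot hmon.ne_zero).mp hlt
    obtain ⟨h2, h3⟩ := hroot a ((hmem a).mp h0)
    refine aeval_derivative_Qq_ne_zero h2 h3 ?_
    rw [hderiv a h0, show (derivative T).eval a = 0 from h1, mul_zero]
  have hroots : T.roots = (QqRoots (n + 2) \ {-1}).val := by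
    refine (Multiset.Nodup.ext hnodup (Finset.nodup _)).mpr fun a => ?_
    rw [mem_roots hmon.ne_zero, IsRoot.def, hmem, Finset.mem_val]
  have hnodal : T = Lagrange.nodal (QqRoots (n + 2) \ {-1}) id := by
    conv_lhs => rw [(IsAlgClosed.splits T).eq_prod_roots_of_monic hmon, hroots]
    rfl
  have hcard : (QqRoots (n + 2) \ {-1}).card = 8 * n + 14 := by
    rw [← hdeg, hnodal, Lagrange.natDegree_nodal]
  have hsum := sum_eval_div_derivative_nodal_eq_zero (QqRoots (n + 2) \ {-1})
    ((X ^ (4 * n + 8) - 1) * (X - 1) ^ 2 * X ^ (2 * n + 1)) (by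
      rw [hcard]
      refine lt_of_le_of_lt (b := 6 * n + 12) (Nat.succ_le_succ ?_) (by omega)
      compute_degree
      omega)
  rw [← hnodal] at hsum
  rw [← mul_zero (-2 : ℂ), ← hsum, Finset.mul_sum]
  refine Finset.sum_congr rfl fun a ha => ?_
  have h1 : (a + 1) ^ 2 ≠ 0 := pow_ne_zero 2 fun h => (hroot a ha).2 (by linear_combination h)
  rw [← div_div, summand_eq (hroot a ha).1, hderiv a ((hmem a).mpr ha), mul_left_comm,
    mul_div_mul_left _ _ h1]
  simp only [eval_mul, eval_pow, eval_sub, eval_X, eval_one]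
  ring
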